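/- arXiv:2007.09286 — 13 statements merged into one kernel-verified Lean document; each statement's English description precedes it below -/
import Mathlib

section
/- Let d ≥ 1, λ ≥ 0, and let w : ℝ → Fin d → ℝ be a trajectory of continuous gradient descent: for each i and each time t, the function t ↦ w t i has derivative −2λ·(W(t) − 1)·(W(t)/(w t i)) at t, where W(t) = ∏ i, w t i and all w t i ≠ 0. Then the loss ℓ(t) = (W(t) − 1)² has derivative ℓ'(t) = −4λ·W(t)²·(∑ i, 1/(w t i)²)·ℓ(t) at every t; in particular ℓ'(t) ≤ 0, so the loss is monotonically non-increasing. -/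
theorem HasDerivAt.finsetProd_of_ne_zero {ι : Type*} {u : Finset ι} {f : ι → ℝ → ℝ}
    {f' : ι → ℝ} {x : ℝ} (hf : ∀ i ∈ u, HasDerivAt (f i) (f' i) x)
    (hne : ∀ i ∈ u, f i x ≠ 0) :
    HasDerivAt (fun y => ∏ i ∈ u, f i y) ((∏ i ∈ u, f i x) * ∑ i ∈ u, f' i / f i x) x := by
  classical
  refine (HasDerivAt.fun_finsetProd hf).congr_deriv ?_
  rw [Finset.mul_sum]
  refine Finset.sum_congr rfl fun i hi => ?_
  have := hne i hi
  rw [← Finset.mul_prod_erase u (fun j => f j x) hi, smul_eq_mul]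
  field_simp

/-- For continuous gradient descent on the deep linear network loss
`L(w) = (∏ i, w i − 1)²` with learning rate `λ ≥ 0`, the loss along the trajectory
has derivative `−4λ·W²·(∑ i, 1/(w i)²)·(W − 1)²`, which is nonpositive:
the loss is monotonically non-increasing. -/
theorem continuous_gd_loss_decreases
    (d : ℕ) (hd : 1 ≤ d) (lam : ℝ) (hlam : 0 ≤ lam)
    (w : ℝ → Fin d → ℝ) (hw : ∀ t i, w t i ≠ 0)
    (hderiv : ∀ i t, HasDerivAt (fun s => w s i)
      (-2 * lam * ((∏ j, w t j) - 1) * ((∏ j, w t j) / w t i)) t)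
    (t : ℝ) :
    HasDerivAt (fun s => ((∏ j, w s j) - 1) ^ 2)
      (-4 * lam * (∏ j, w t j) ^ 2 * (∑ j, 1 / (w t j) ^ 2) *
        ((∏ j, w t j) - 1) ^ 2) t ∧
    -4 * lam * (∏ j, w t j) ^ 2 * (∑ j, 1 / (w t j) ^ 2) *
        ((∏ j, w t j) - 1) ^ 2 ≤ 0 := by
  constructor
  · have hprod := HasDerivAt.finsetProd_of_ne_zero (u := Finset.univ)
      (fun i _ => hderiv i t) (fun i _ => hw t i)
    refine ((hprod.sub_const 1).fun_pow 2).congr_deriv ?_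
    simp only [Finset.mul_sum, Finset.sum_mul]
    refine Finset.sum_congr rfl fun i _ => ?_
    have := hw t i
    field_simp
    push_cast
    ring
  · have : 0 ≤ lam * (∏ j, w t j) ^ 2 * (∑ j, 1 / (w t j) ^ 2) * ((∏ j, w t j) - 1) ^ 2 := by
      positivity
    linarith
end

section
/- Let d ≥ 1, λ ∈ ℝ, and let w : ℝ → Fin d → ℝ be a trajectory of continuous gradient descent: for each i and each time t, the function t ↦ w t i has derivative −2λ·(W(t) − 1)·(W(t)/(w t i)) at t, where W(t) = ∏ i, w t i and all w t i ≠ 0. Then for any pair of indices i, j, the layer imbalance (w t i)² − (w t j)² has derivative 0 at every t, and hence (w t i)² − (w t j)² = (w 0 i)² − (w 0 j)² for all t (the trajectory stays on a hyperbola). -/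
/-- For continuous gradient descent on the deep linear network loss
`L(w) = (∏ i, w i − 1)²`, the layer imbalance `(w t i)² − (w t j)²` has zero
derivative at every time, hence is conserved along the trajectory
(the trajectory stays on a hyperbola). -/
theorem continuous_gd_imbalance_conserved
    (d : ℕ) (hd : 1 ≤ d) (lam : ℝ)
    (w : ℝ → Fin d → ℝ) (hw : ∀ t i, w t i ≠ 0)
    (hderiv : ∀ i t, HasDerivAt (fun s => w s i)
      (-2 * lam * ((∏ j, w t j) - 1) * ((∏ j, w t j) / w t i)) t)
    (i j : Fin d) :
    (∀ t, HasDerivAt (fun s => (w s i) ^ 2 - (w s j) ^ 2) 0 t) ∧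
    ∀ t, (w t i) ^ 2 - (w t j) ^ 2 = (w 0 i) ^ 2 - (w 0 j) ^ 2 := by
  have hsq : ∀ k t, HasDerivAt (fun s => (w s k) ^ 2)
      (-4 * lam * ((∏ j, w t j) - 1) * ∏ j, w t j) t := by
    intro k t
    refine ((hderiv k t).fun_pow 2).congr_deriv ?_
    have hk := hw t k
    generalize ∏ j, w t j = W
    push_cast
    field_simp
    ring
  have h : ∀ t, HasDerivAt (fun s => (w s i) ^ 2 - (w s j) ^ 2) 0 t := fun t =>
    ((hsq i t).fun_sub (hsq j t)).congr_deriv (sub_self _)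
  exact ⟨h, fun t => is_const_of_deriv_eq_zero
    (fun s => (h s).differentiableAt) (fun s => (h s).deriv) t 0⟩
end

section
/- (Theorem 1, one-step form.) Let d ≥ 1, let w : Fin d → ℝ with all w i ≠ 0, set W = ∏ i, w i, and assume |W − 1| < 1/2. Define the adaptive learning rate λ = 1/(4·∑ i, 1/(w i)²) and the updated weights w' i = w i − 2λ·(W − 1)·(W/(w i)), with W' = ∏ i, w' i. Then |W' − 1| ≤ (59/64)·|W − 1|; consequently the loss satisfies L(w') ≤ (59/64)²·L(w). -/
/-- Bernoulli-type lower bound for a product with weights summing to one. -/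
theorem one_add_le_prod_one_add_mul {ι : Type*} (u : Finset ι) (p : ι → ℝ) (s : ℝ) (hs : -1 < s)
    (hp : ∀ i ∈ u, 0 ≤ p i) (hsum : ∑ i ∈ u, p i = 1) :
    1 + s ≤ ∏ i ∈ u, (1 + s * p i) := by
  have hs' : 0 < 1 + s := by linarith
  calc 1 + s = ∏ i ∈ u, (1 + s) ^ p i := by
        rw [← Real.rpow_sum_of_pos hs', hsum, Real.rpow_one]
    _ ≤ ∏ i ∈ u, (1 + s * p i) := by
        refine Finset.prod_le_prod (fun i _ => Real.rpow_nonneg hs'.le _) fun i hi => ?_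
        rw [mul_comm s]
        exact rpow_one_add_le_one_add_mul_self hs.le (hp i hi)
          (hsum ▸ Finset.single_le_sum hp hi)

/-- Exponential-type upper bound for a product with weights summing to one. -/
theorem prod_one_add_mul_mul_one_sub_le_one {ι : Type*} (u : Finset ι) (p : ι → ℝ) (s : ℝ)
    (hs : -1 < s) (hs₁ : s < 1) (hp : ∀ i ∈ u, 0 ≤ p i) (hsum : ∑ i ∈ u, p i = 1) :
    (∏ i ∈ u, (1 + s * p i)) * (1 - s) ≤ 1 := by
  have hprod : ∏ i ∈ u, (1 + s * p i) ≤ Real.exp s := by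
    calc ∏ i ∈ u, (1 + s * p i) ≤ ∏ i ∈ u, Real.exp (s * p i) := by
          refine Finset.prod_le_prod (fun i hi => ?_) fun i _ => ?_
          · have h₁ : p i ≤ 1 := hsum ▸ Finset.single_le_sum hp hi
            nlinarith [hp i hi]
          · linarith [Real.add_one_le_exp (s * p i)]
      _ = Real.exp s := by rw [← Real.exp_sum, ← Finset.mul_sum, hsum, mul_one]
  calc (∏ i ∈ u, (1 + s * p i)) * (1 - s) ≤ Real.exp s * Real.exp (-s) :=
        mul_le_mul hprod (Real.one_sub_le_exp_neg s) (by linarith) (Real.exp_pos s).le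
    _ = 1 := by rw [← Real.exp_add, add_neg_cancel, Real.exp_zero]

/-- If the end-to-end map `W` is multiplied by a factor between `1 + s` and `1 / (1 - s)`, where
`s = -(W - 1) * W / 2`, then its distance to `1` contracts by `59 / 64`. -/
theorem abs_mul_sub_one_le_of_factor_bounds (W Q : ℝ) (hW : |W - 1| < 1 / 2)
    (hlow : 1 + -((W - 1) * W / 2) ≤ Q) (hup : Q * (1 - -((W - 1) * W / 2)) ≤ 1) :
    |W * Q - 1| ≤ 59 / 64 * |W - 1| := by
  obtain ⟨h₁, h₂⟩ := abs_lt.mp hW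
  have hW₀ : 0 < W := by linarith
  have hden : 0 < 1 - -((W - 1) * W / 2) := by nlinarith
  have hlow' : 1 + (W - 1) * (1 - W ^ 2 / 2) ≤ W * Q := by
    nlinarith [mul_le_mul_of_nonneg_left hlow hW₀.le]
  have hup' : W * Q * (1 - -((W - 1) * W / 2)) ≤ W := by
    nlinarith [mul_le_mul_of_nonneg_left hup hW₀.le]
  have hsq : 1 / 4 ≤ W ^ 2 := by nlinarith
  have hsq' : W ^ 2 ≤ 9 / 4 := by nlinarith
  rcases le_total 0 (W - 1) with he | he
  · rw [abs_of_nonneg he, abs_le]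
    constructor
    · nlinarith [mul_le_mul_of_nonneg_left hsq' he]
    · have : W * Q ≤ 1 + 59 / 64 * (W - 1) := by
        refine le_of_mul_le_mul_right (hup'.trans ?_) hden
        have : 0 ≤ (W - 1) * (59 / 64 - 1 + W / 2 + 59 / 64 * ((W - 1) * W / 2)) := by
          apply mul_nonneg he
          nlinarith [mul_nonneg he hW₀.le]
        nlinarith
      linarith
  · rw [abs_of_nonpos he, abs_le]
    constructor
    · nlinarith [mul_le_mul_of_nonpos_left hsq he]
    · have : W * Q ≤ 1 + 59 / 64 * (1 - W) := by
        refine le_of_mul_le_mul_right (hup'.trans ?_) hden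
        have he' : 0 ≤ 1 - W := by linarith
        have : 0 ≤ (1 - W) * (59 / 64 + 1 - W / 2 - 59 / 64 * ((1 - W) * W / 2)) := by
          apply mul_nonneg he'
          nlinarith [sq_nonneg (W - 1 / 2)]
        nlinarith
      linarith


/-- (Theorem 1, one-step form.) One gradient descent step on the deep linear
network loss with adaptive learning rate `λ = 1/(4 ∑ i, 1/(w i)²)`, starting
from weights with `|W − 1| < 1/2`, contracts the residual by a factor `59/64`,
hence contracts the loss by `(59/64)²`. -/
theorem gd_adaptive_lr_loss_contracts
    (d : ℕ) (hd : 1 ≤ d) (w : Fin d → ℝ) (hw : ∀ i, w i ≠ 0)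
    (hW : |(∏ i, w i) - 1| < 1 / 2)
    (lam : ℝ) (hlam : lam = 1 / (4 * ∑ i, 1 / (w i) ^ 2))
    (w' : Fin d → ℝ)
    (hw' : ∀ i, w' i = w i - 2 * lam * ((∏ j, w j) - 1) * ((∏ j, w j) / w i)) :
    |(∏ i, w' i) - 1| ≤ (59 / 64) * |(∏ i, w i) - 1| ∧
      ((∏ i, w' i) - 1) ^ 2 ≤ (59 / 64) ^ 2 * ((∏ i, w i) - 1) ^ 2 := by
  set W := ∏ i, w i with hWdef
  have hterm : ∀ i, 0 < 1 / w i ^ 2 := fun i => by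
    have := hw i
    positivity
  have hS : 0 < ∑ i, 1 / w i ^ 2 :=
    Finset.sum_pos (fun i _ => hterm i) ⟨⟨0, hd⟩, Finset.mem_univ _⟩
  set S := ∑ i, 1 / w i ^ 2 with hSdef
  have hp : ∀ i ∈ Finset.univ, 0 ≤ 1 / w i ^ 2 / S := fun i _ => (div_pos (hterm i) hS).le
  have hsum : ∑ i, 1 / w i ^ 2 / S = 1 := by
    rw [← Finset.sum_div, ← hSdef, div_self hS.ne']
  have hprod : ∏ i, w' i = W * ∏ i, (1 + -((W - 1) * W / 2) * (1 / w i ^ 2 / S)) := by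
    rw [hWdef, ← Finset.prod_mul_distrib, ← hWdef]
    refine Finset.prod_congr rfl fun i _ => ?_
    rw [hw' i, hlam]
    have := hw i
    have := hS.ne'
    field_simp
    ring
  obtain ⟨h₁, h₂⟩ := abs_lt.mp hW
  have hs : -1 < -((W - 1) * W / 2) := by nlinarith
  have hs₁ : -((W - 1) * W / 2) < 1 := by nlinarith
  have hmain : |(∏ i, w' i) - 1| ≤ 59 / 64 * |W - 1| := by
    rw [hprod]
    exact abs_mul_sub_one_le_of_factor_bounds W _ hW
      (one_add_le_prod_one_add_mul _ _ _ hs hp hsum)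
      (prod_one_add_mul_mul_one_sub_le_one _ _ _ hs hs₁ hp hsum)
  refine ⟨hmain, ?_⟩
  rw [← sq_abs, ← sq_abs (W - 1), ← mul_pow]
  exact pow_le_pow_left₀ (abs_nonneg _) hmain 2
end

section
/- (Theorem 1, iterated form.) Let d ≥ 1 and let w(0) : Fin d → ℝ have all coordinates nonzero with |W(0) − 1| < 1/2, where W(t) = ∏ i, w(t) i. Define recursively w(t+1) i = w(t) i − 2λ(t)·(W(t) − 1)·(W(t)/(w(t) i)) with adaptive learning rate λ(t) = 1/(4·∑ i, 1/(w(t) i)²). Then for every t all coordinates w(t) i are nonzero (so the recursion is well defined), |W(t) − 1| < 1/2, and the loss converges to 0 at a linear rate: (W(t) − 1)² ≤ (59/64)^{2t}·(W(0) − 1)². -/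
/-- A Bernoulli-type inequality for sub-probability weights `p` and `|a| ≤ 1`. -/
theorem one_sub_mul_sum_le_prod {ι : Type*} (s : Finset ι) (p : ι → ℝ) (a : ℝ)
    (ha : |a| ≤ 1) (hp : ∀ i ∈ s, 0 ≤ p i) (hs : ∑ i ∈ s, p i ≤ 1) :
    1 - a * ∑ i ∈ s, p i ≤ ∏ i ∈ s, (1 - a * p i) := by
  classical
  obtain ⟨ha₁, ha₂⟩ := abs_le.mp ha
  induction s using Finset.induction_on with
  | empty => simp
  | insert i s hi ih =>
    rw [Finset.sum_insert hi] at hs ⊢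
    rw [Finset.prod_insert hi]
    have hpi := hp i (Finset.mem_insert_self i s)
    have hps : ∀ j ∈ s, 0 ≤ p j := fun j hj => hp j (Finset.mem_insert_of_mem hj)
    have hsum := Finset.sum_nonneg hps
    have h := mul_le_mul_of_nonneg_left (ih hps (by linarith))
      (show 0 ≤ 1 - a * p i by nlinarith)
    nlinarith [mul_nonneg (sq_nonneg a) (mul_nonneg hpi hsum)]

theorem prod_one_sub_mul_one_add_sum_le_one {ι : Type*} (s : Finset ι) (p : ι → ℝ) (a : ℝ)
    (ha : |a| ≤ 1) (hp : ∀ i ∈ s, 0 ≤ p i) (hs : ∑ i ∈ s, p i ≤ 1) :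
    (∏ i ∈ s, (1 - a * p i)) * (1 + a * ∑ i ∈ s, p i) ≤ 1 := by
  obtain ⟨ha₁, ha₂⟩ := abs_le.mp ha
  have hp1 : ∀ i ∈ s, p i ≤ 1 := fun i hi => (Finset.single_le_sum hp hi).trans hs
  have hnn : ∀ i ∈ s, 0 ≤ 1 - a * p i := fun i hi => by nlinarith [hp i hi, hp1 i hi]
  have h := one_sub_mul_sum_le_prod s p (-a) (by rwa [abs_neg]) hp hs
  simp only [neg_mul, sub_neg_eq_add] at h
  refine (mul_le_mul_of_nonneg_left h (Finset.prod_nonneg hnn)).trans ?_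
  rw [← Finset.prod_mul_distrib]
  refine Finset.prod_le_one (fun i hi => mul_nonneg (hnn i hi) ?_) (fun i hi => ?_)
  · nlinarith [hp i hi, hp1 i hi]
  · nlinarith [sq_nonneg (a * p i)]

/-- The scalar estimate behind the contraction of the end-to-end map `W`, whose update
multiplies it by a factor `Q` between `1 - a` and `1 / (1 + a)`. -/
theorem abs_mul_sub_one_le {W Q a : ℝ} (hW : |W - 1| < 1 / 2) (ha : a = (W - 1) * W / 2)
    (hl : 1 - a ≤ Q) (hu : Q * (1 + a) ≤ 1) :
    |W * Q - 1| ≤ 59 / 64 * |W - 1| := by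
  obtain ⟨hW₁, hW₂⟩ := abs_lt.mp hW
  have hW0 : 0 < W := by linarith
  have ha1 : 0 < 1 + a := by rw [ha]; nlinarith
  have hl' : W * (1 - a) ≤ W * Q := mul_le_mul_of_nonneg_left hl hW0.le
  have hu' : (1 + a) * (W * Q - 1) ≤ (W - 1) * (1 - W / 2) := by
    have := mul_le_mul_of_nonneg_left hu hW0.le
    rw [ha] at this ⊢
    linarith
  have hl'' : (W - 1) * (1 - W ^ 2 / 2) ≤ W * Q - 1 := by
    rw [ha] at hl'
    linarith
  rcases le_total 1 W with h | h
  · have he : 0 ≤ W - 1 := by linarith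
    have ha0 : 0 ≤ a := by rw [ha]; positivity
    rw [abs_of_nonneg he, abs_le]
    constructor
    · refine le_trans ?_ hl''
      nlinarith [mul_nonneg he (show 0 ≤ 1 - W ^ 2 / 2 + 59 / 64 by nlinarith)]
    · refine le_of_mul_le_mul_left (hu'.trans ?_) ha1
      nlinarith [mul_nonneg he ha0, mul_nonneg he he]
  · have he : 0 ≤ 1 - W := by linarith
    rw [abs_of_nonpos (by linarith : W - 1 ≤ 0), abs_le]
    constructor
    · refine le_trans ?_ hl''
      nlinarith [mul_nonneg he (show 0 ≤ 59 / 64 - (1 - W ^ 2 / 2) by nlinarith)]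
    · refine le_of_mul_le_mul_left (hu'.trans ?_) ha1
      nlinarith [mul_nonneg he ha1.le, mul_nonneg he (show 0 ≤ 1 - W / 2 by linarith)]

/-- One step of gradient descent with the adaptive learning rate keeps the weights nonzero
and contracts the distance of the end-to-end map to `1`. -/
theorem gd_adaptive_lr_step {ι : Type*} [Fintype ι] [Nonempty ι] (w w' : ι → ℝ)
    (h0 : ∀ i, w i ≠ 0) (hW : |(∏ i, w i) - 1| < 1 / 2)
    (hstep : ∀ i, w' i = w i -
      2 * (1 / (4 * ∑ j, 1 / (w j) ^ 2)) * ((∏ j, w j) - 1) * ((∏ j, w j) / w i)) :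
    (∀ i, w' i ≠ 0) ∧ |(∏ i, w' i) - 1| ≤ 59 / 64 * |(∏ i, w i) - 1| := by
  set W := ∏ i, w i with hWdef
  set S := ∑ j, 1 / (w j) ^ 2 with hS
  have hpos : ∀ i, 0 < 1 / (w i) ^ 2 := fun i => by have := h0 i; positivity
  have hSpos : 0 < S := Finset.sum_pos (fun i _ => hpos i) Finset.univ_nonempty
  set p : ι → ℝ := fun i => 1 / (w i) ^ 2 / S with hp
  set a := (W - 1) * W / 2 with ha
  have hp0 : ∀ i ∈ Finset.univ, 0 ≤ p i := fun i _ => (div_pos (hpos i) hSpos).le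
  have hsum : ∑ i, p i = 1 := by rw [← Finset.sum_div, ← hS, div_self hSpos.ne']
  obtain ⟨hW₁, hW₂⟩ := abs_lt.mp hW
  have ha1 : |a| < 1 := by rw [abs_lt, ha]; constructor <;> nlinarith
  have hw' : ∀ i, w' i = w i * (1 - a * p i) := fun i => by
    have := h0 i
    have := hSpos.ne'
    rw [hstep, ha, hp]
    field_simp
    ring
  have hl := one_sub_mul_sum_le_prod Finset.univ p a ha1.le hp0 hsum.le
  have hu := prod_one_sub_mul_one_add_sum_le_one Finset.univ p a ha1.le hp0 hsum.le
  rw [hsum, mul_one] at hl hu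
  refine ⟨fun i => ?_, ?_⟩
  · have hp1 : p i ≤ 1 := (Finset.single_le_sum hp0 (Finset.mem_univ i)).trans hsum.le
    have hpi := hp0 i (Finset.mem_univ i)
    have : 0 < 1 - a * p i := by
      nlinarith [mul_le_mul_of_nonneg_right (le_abs_self a) hpi,
        mul_le_of_le_one_right (abs_nonneg a) hp1]
    rw [hw']
    exact mul_ne_zero (h0 i) this.ne'
  · simp only [hw', Finset.prod_mul_distrib]
    exact abs_mul_sub_one_le hW ha hl hu

/-- (Theorem 1, iterated form.) Gradient descent on the deep linear network loss
with the adaptive learning rate `λ(t) = 1/(4 ∑ i, 1/(w t i)²)`, started from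
weights with nonzero coordinates and `|W(0) − 1| < 1/2`, keeps all coordinates
nonzero, keeps `|W(t) − 1| < 1/2`, and the loss converges to `0` at the linear
rate `(59/64)^(2t)`. -/
theorem gd_adaptive_lr_linear_convergence
    (d : ℕ) (hd : 1 ≤ d) (w : ℕ → Fin d → ℝ)
    (h0 : ∀ i, w 0 i ≠ 0) (hW0 : |(∏ i, w 0 i) - 1| < 1 / 2)
    (hstep : ∀ t i, w (t + 1) i = w t i -
      2 * (1 / (4 * ∑ j, 1 / (w t j) ^ 2)) * ((∏ j, w t j) - 1) *
        ((∏ j, w t j) / w t i)) :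
    ∀ t, (∀ i, w t i ≠ 0) ∧ |(∏ i, w t i) - 1| < 1 / 2 ∧
      ((∏ i, w t i) - 1) ^ 2 ≤ (59 / 64) ^ (2 * t) * ((∏ i, w 0 i) - 1) ^ 2 := by
  have : Nonempty (Fin d) := ⟨⟨0, hd⟩⟩
  intro t
  induction t with
  | zero => exact ⟨h0, hW0, by simp⟩
  | succ t ih =>
    obtain ⟨hne, hW, hloss⟩ := ih
    obtain ⟨hne', hle⟩ := gd_adaptive_lr_step (w t) (w (t + 1)) hne hW (hstep t)
    refine ⟨hne', by linarith [abs_nonneg ((∏ i, w t i) - 1)], ?_⟩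
    have hsq := pow_le_pow_left₀ (abs_nonneg _) hle 2
    rw [mul_pow, sq_abs, sq_abs] at hsq
    calc _ ≤ _ := hsq
      _ ≤ (59 / 64) ^ 2 * ((59 / 64) ^ (2 * t) * ((∏ i, w 0 i) - 1) ^ 2) := by gcongr
      _ = _ := by ring
end

section
/- Let d ≥ 2, λ ∈ ℝ, w : Fin d → ℝ with all w i ≠ 0, W = ∏ i, w i, and let w' i = w i − 2λ·(W − 1)·(W/(w i)) be the gradient-descent-updated weights. Then for any indices i ≠ j the layer imbalance satisfies the exact identity (w' i)² − (w' j)² = ((w i)² − (w j)²)·(1 − 4λ²·(W − 1)²·W²/((w i)·(w j))²). -/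
/-- Exact identity for the layer imbalance after one gradient descent step on
the deep linear network loss: `D'_ij = D_ij · (1 − 4λ²(W − 1)²W²/((w i)(w j))²)`. -/
theorem gd_step_imbalance_identity
    (d : ℕ) (hd : 2 ≤ d) (lam : ℝ) (w : Fin d → ℝ) (hw : ∀ i, w i ≠ 0)
    (w' : Fin d → ℝ)
    (hw' : ∀ i, w' i = w i - 2 * lam * ((∏ l, w l) - 1) * ((∏ l, w l) / w i))
    (i j : Fin d) (hij : i ≠ j) :
    (w' i) ^ 2 - (w' j) ^ 2 =
      ((w i) ^ 2 - (w j) ^ 2) *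
        (1 - 4 * lam ^ 2 * ((∏ l, w l) - 1) ^ 2 * (∏ l, w l) ^ 2 /
          (w i * w j) ^ 2) := by
  have hi := hw i
  have hj := hw j
  rw [hw' i, hw' j]
  generalize ∏ l, w l = W
  field_simp
  ring
end

section
/- (Theorem 2.) Let d ≥ 2, let w : Fin d → ℝ with all w i ≠ 0, set W = ∏ i, w i, and assume |W − 1| < 1/2. Define the adaptive learning rate λ = 1/(4·∑ i, 1/(w i)²) and the updated weights w' i = w i − 2λ·(W − 1)·(W/(w i)). Then for any indices i ≠ j, the factor k = 1 − 4λ²·(W − 1)²·W²/((w i)·(w j))² satisfies 247/256 < k ≤ 1, and consequently the layer imbalance monotonically decreases: |(w' i)² − (w' j)²| ≤ |(w i)² − (w j)²|, with the sign of (w' i)² − (w' j)² equal to that of (w i)² − (w j)². -/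
theorem sign_mul_of_pos {c : ℝ} (hc : 0 < c) (x : ℝ) : Real.sign (c * x) = Real.sign x := by
  rcases lt_trichotomy x 0 with h | rfl | h
  · rw [Real.sign_of_neg h, Real.sign_of_neg (mul_neg_of_pos_of_neg hc h)]
  · rw [mul_zero]
  · rw [Real.sign_of_pos h, Real.sign_of_pos (mul_pos hc h)]

theorem four_mul_mul_le_one_sixteenth_of_adaptive_lr {ι : Type*} [Fintype ι]
    (w : ι → ℝ) (hw : ∀ i, w i ≠ 0)
    (lam : ℝ) (hlam : lam = 1 / (4 * ∑ i, 1 / (w i) ^ 2)) {i j : ι} (hij : i ≠ j) :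
    4 * (lam ^ 2 * (1 / (w i) ^ 2) * (1 / (w j) ^ 2)) ≤ 1 / 16 := by
  classical
  have hinv : ∀ k, 0 < 1 / (w k) ^ 2 := fun k => by have := hw k; positivity
  have hS : 1 / (w i) ^ 2 + 1 / (w j) ^ 2 ≤ ∑ k, 1 / (w k) ^ 2 := by
    rw [← Finset.sum_pair (f := fun k => 1 / (w k) ^ 2) hij]
    exact Finset.sum_le_sum_of_subset_of_nonneg (Finset.subset_univ _)
      fun k _ _ => (hinv k).le
  have hi := hinv i
  have hj := hinv j
  generalize 1 / (w i) ^ 2 = a at *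
  generalize 1 / (w j) ^ 2 = b at *
  generalize (∑ k, 1 / (w k) ^ 2) = S at *
  have hSpos : 0 < S := by linarith
  have hlampos : 0 < lam := by rw [hlam]; positivity
  have hlamS : lam * S = 1 / 4 := by rw [hlam]; field_simp
  have hle : lam * (a + b) ≤ 1 / 4 := hlamS ▸ mul_le_mul_of_nonneg_left hS hlampos.le
  have hsq : (lam * (a + b)) ^ 2 ≤ (1 / 4) ^ 2 := pow_le_pow_left₀ (by positivity) hle 2
  nlinarith [sq_nonneg (lam * (a - b))]


/-- (Theorem 2.) For one gradient descent step on the deep linear network loss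
with adaptive learning rate `λ = 1/(4 ∑ i, 1/(w i)²)` and `|W − 1| < 1/2`, the
contraction factor `k = 1 − 4λ²(W − 1)²W²/((w i)(w j))²` satisfies
`247/256 < k ≤ 1`; hence the layer imbalance monotonically decreases and keeps
its sign. -/
theorem gd_adaptive_lr_imbalance_decreases
    (d : ℕ) (hd : 2 ≤ d) (w : Fin d → ℝ) (hw : ∀ i, w i ≠ 0)
    (hW : |(∏ i, w i) - 1| < 1 / 2)
    (lam : ℝ) (hlam : lam = 1 / (4 * ∑ i, 1 / (w i) ^ 2))
    (w' : Fin d → ℝ)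
    (hw' : ∀ i, w' i = w i - 2 * lam * ((∏ l, w l) - 1) * ((∏ l, w l) / w i))
    (i j : Fin d) (hij : i ≠ j) :
    (247 / 256 < 1 - 4 * lam ^ 2 * ((∏ l, w l) - 1) ^ 2 * (∏ l, w l) ^ 2 /
        (w i * w j) ^ 2 ∧
      1 - 4 * lam ^ 2 * ((∏ l, w l) - 1) ^ 2 * (∏ l, w l) ^ 2 /
        (w i * w j) ^ 2 ≤ 1) ∧
    |(w' i) ^ 2 - (w' j) ^ 2| ≤ |(w i) ^ 2 - (w j) ^ 2| ∧
    Real.sign ((w' i) ^ 2 - (w' j) ^ 2) = Real.sign ((w i) ^ 2 - (w j) ^ 2) := by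
  have hcross := four_mul_mul_le_one_sixteenth_of_adaptive_lr w hw lam hlam hij
  rw [hw' i, hw' j]
  generalize (∏ l, w l) = W at *
  have hi := hw i
  have hj := hw j
  generalize w i = x at *
  generalize w j = y at *
  obtain ⟨h1, h2⟩ := abs_lt.1 hW
  have hlt : ((W - 1) * W) ^ 2 < 9 / 16 := by
    have : |(W - 1) * W| < 3 / 4 := abs_lt.2 ⟨by nlinarith, by nlinarith⟩
    have := sq_lt_sq' (abs_lt.1 this).1 (abs_lt.1 this).2
    linarith
  have hk : 4 * lam ^ 2 * (W - 1) ^ 2 * W ^ 2 / (x * y) ^ 2 =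
      4 * (lam ^ 2 * (1 / x ^ 2) * (1 / y ^ 2)) * ((W - 1) * W) ^ 2 := by
    field_simp
  have hfactor : (x - 2 * lam * (W - 1) * (W / x)) ^ 2 - (y - 2 * lam * (W - 1) * (W / y)) ^ 2 =
      (1 - 4 * lam ^ 2 * (W - 1) ^ 2 * W ^ 2 / (x * y) ^ 2) * (x ^ 2 - y ^ 2) := by
    field_simp
    ring
  have hnonneg : 0 ≤ 4 * lam ^ 2 * (W - 1) ^ 2 * W ^ 2 / (x * y) ^ 2 := by positivity
  have hupper : 4 * lam ^ 2 * (W - 1) ^ 2 * W ^ 2 / (x * y) ^ 2 < 9 / 256 := by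
    rw [hk]
    nlinarith [mul_le_mul_of_nonneg_right hcross (sq_nonneg ((W - 1) * W))]
  rw [hfactor]
  generalize 4 * lam ^ 2 * (W - 1) ^ 2 * W ^ 2 / (x * y) ^ 2 = q at *
  have hpos : 0 < 1 - q := by linarith
  refine ⟨⟨by linarith, by linarith⟩, ?_, sign_mul_of_pos hpos _⟩
  rw [abs_mul, abs_of_pos hpos]
  exact mul_le_of_le_one_left (abs_nonneg _) (by linarith)
end

section
/- Let d ≥ 1, λ, μ ∈ ℝ, and let w : ℝ → Fin d → ℝ be a trajectory of continuous gradient descent with weight decay: for each i and each t, the function t ↦ w t i has derivative −2λ·((W(t) − 1)·(W(t)/(w t i)) + μ·(w t i)) at t, where W(t) = ∏ i, w t i and all w t i ≠ 0. Then for any indices i, j the layer imbalance satisfies d/dt ((w t i)² − (w t j)²) = −4λμ·((w t i)² − (w t j)²); hence (w t i)² − (w t j)² = exp(−4λμ t)·((w 0 i)² − (w 0 j)²), so for λ, μ > 0 the layer imbalance decays exponentially to 0. -/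
/-- A solution of the scalar linear equation `f' = c * f` on `ℝ` is `exp (c * t) * f 0`. -/
theorem eq_exp_mul_of_hasDerivAt {f : ℝ → ℝ} {c : ℝ}
    (hf : ∀ t, HasDerivAt f (c * f t) t) (t : ℝ) :
    f t = Real.exp (c * t) * f 0 := by
  have hg : ∀ s, HasDerivAt (fun s => Real.exp (-(c * s)) * f s) 0 s := by
    intro s
    have hexp := (((hasDerivAt_id s).const_mul c).neg).exp
    refine (hexp.mul (hf s)).congr_deriv ?_
    simp only [Pi.neg_apply, id_eq]
    ring
  have hconst := is_const_of_deriv_eq_zero (fun s => (hg s).differentiableAt)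
    (fun s => (hg s).deriv) t 0
  simp only [mul_zero, neg_zero, Real.exp_zero, one_mul] at hconst
  rw [← hconst, ← mul_assoc, ← Real.exp_add, add_neg_cancel, Real.exp_zero, one_mul]

/-- For continuous gradient descent with weight decay `μ` on the deep linear
network, the layer imbalance satisfies `d/dt D_ij = −4λμ·D_ij`, hence decays
exponentially: `D_ij(t) = exp(−4λμt)·D_ij(0)`. -/
theorem weight_decay_imbalance_decays
    (d : ℕ) (hd : 1 ≤ d) (lam mu : ℝ)
    (w : ℝ → Fin d → ℝ) (hw : ∀ t i, w t i ≠ 0)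
    (hderiv : ∀ i t, HasDerivAt (fun s => w s i)
      (-2 * lam * (((∏ l, w t l) - 1) * ((∏ l, w t l) / w t i) + mu * w t i)) t)
    (i j : Fin d) :
    (∀ t, HasDerivAt (fun s => (w s i) ^ 2 - (w s j) ^ 2)
      (-4 * lam * mu * ((w t i) ^ 2 - (w t j) ^ 2)) t) ∧
    ∀ t, (w t i) ^ 2 - (w t j) ^ 2 =
      Real.exp (-4 * lam * mu * t) * ((w 0 i) ^ 2 - (w 0 j) ^ 2) := by
  have hD : ∀ t, HasDerivAt (fun s => (w s i) ^ 2 - (w s j) ^ 2)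
      (-4 * lam * mu * ((w t i) ^ 2 - (w t j) ^ 2)) t := by
    intro t
    refine (((hderiv i t).pow 2).sub ((hderiv j t).pow 2)).congr_deriv ?_
    have hi := hw t i
    have hj := hw t j
    generalize ∏ l, w t l = W
    push_cast
    field_simp
    ring
  exact ⟨hD, eq_exp_mul_of_hasDerivAt hD⟩
end

section
/- Let d ≥ 1, λ, μ ∈ ℝ, and let w : ℝ → Fin d → ℝ be a trajectory of continuous gradient descent with weight decay: for each i and each t, the function t ↦ w t i has derivative −2λ·((W(t) − 1)·(W(t)/(w t i)) + μ·(w t i)) at t, where W(t) = ∏ i, w t i and all w t i ≠ 0. Then the (unregularized) loss ℓ(t) = (W(t) − 1)² has derivative ℓ'(t) = −4λ·((W(t) − 1)²·W(t)²·(∑ i, 1/(w t i)²) + μ·d·(W(t) − 1)·W(t)) at every t. In particular, if λ > 0, μ > 0 and W(t) > 1 or 0 < W(t) < 1 − μ·d/(W(t)·∑ i, 1/(w t i)²), then ℓ'(t) < 0, i.e., the loss strictly decreases outside the weight-decay band. -/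
/-- For continuous gradient descent with weight decay `μ` on the deep linear
network, the unregularized loss `ℓ(t) = (W(t) − 1)²` has derivative
`−4λ((W − 1)²W²(∑ 1/wᵢ²) + μ·d·(W − 1)W)`; in particular, for `λ, μ > 0` the
loss strictly decreases outside the weight-decay band. -/
theorem weight_decay_loss_derivative
    (d : ℕ) (hd : 1 ≤ d) (lam mu : ℝ)
    (w : ℝ → Fin d → ℝ) (hw : ∀ t i, w t i ≠ 0)
    (hderiv : ∀ i t, HasDerivAt (fun s => w s i)
      (-2 * lam * (((∏ l, w t l) - 1) * ((∏ l, w t l) / w t i) + mu * w t i)) t)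
    (t : ℝ) :
    HasDerivAt (fun s => ((∏ l, w s l) - 1) ^ 2)
      (-4 * lam * (((∏ l, w t l) - 1) ^ 2 * (∏ l, w t l) ^ 2 * (∑ l, 1 / (w t l) ^ 2)
        + mu * d * ((∏ l, w t l) - 1) * (∏ l, w t l))) t ∧
    (0 < lam → 0 < mu →
      (1 < (∏ l, w t l) ∨
        (0 < (∏ l, w t l) ∧
          (∏ l, w t l) < 1 - mu * d / ((∏ l, w t l) * ∑ l, 1 / (w t l) ^ 2))) →
      -4 * lam * (((∏ l, w t l) - 1) ^ 2 * (∏ l, w t l) ^ 2 * (∑ l, 1 / (w t l) ^ 2)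
        + mu * d * ((∏ l, w t l) - 1) * (∏ l, w t l)) < 0) := by
  have hprod : HasDerivAt (fun s => ∏ l, w s l)
      (-2 * lam * (((∏ l, w t l) - 1) * (∏ l, w t l) ^ 2 * (∑ l, 1 / (w t l) ^ 2)
        + mu * d * (∏ l, w t l))) t := by
    refine (HasDerivAt.fun_finsetProd (u := Finset.univ) (fun i _ => hderiv i t)).congr_deriv ?_
    have hterm : ∀ i ∈ Finset.univ, (∏ j ∈ Finset.univ.erase i, w t j) •
        (-2 * lam * (((∏ l, w t l) - 1) * ((∏ l, w t l) / w t i) + mu * w t i)) =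
        -2 * lam * (((∏ l, w t l) - 1) * (∏ l, w t l) ^ 2 * (1 / (w t i) ^ 2)
          + mu * (∏ l, w t l)) := by
      intro i hi
      have herase : ∏ j ∈ Finset.univ.erase i, w t j = (∏ l, w t l) / w t i :=
        eq_div_of_mul_eq (hw t i) (Finset.prod_erase_mul _ _ hi)
      have hwi := hw t i
      rw [herase, smul_eq_mul]
      field_simp
    rw [Finset.sum_congr rfl hterm, ← Finset.mul_sum, Finset.sum_add_distrib,
      ← Finset.mul_sum, Finset.sum_const, Finset.card_univ, Fintype.card_fin, nsmul_eq_mul]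
    ring
  refine ⟨?_, fun hlam hmu hW => ?_⟩
  · refine ((hprod.sub_const 1).fun_pow 2).congr_deriv ?_
    push_cast
    ring
  · have hS : 0 < ∑ l, 1 / (w t l) ^ 2 :=
      Finset.sum_pos (fun i _ => one_div_pos.2 (sq_pos_of_ne_zero (hw t i)))
        ⟨⟨0, hd⟩, Finset.mem_univ _⟩
    have hd' : (0 : ℝ) < d := by exact_mod_cast hd
    generalize ∑ l, 1 / (w t l) ^ 2 = S at hS hW ⊢
    generalize ∏ l, w t l = W at hW ⊢
    refine mul_neg_of_neg_of_pos (by linarith) ?_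
    rcases hW with hW | ⟨hW0, hW⟩
    · have h1 : 0 < W - 1 := by linarith
      have h0 : 0 < W := by linarith
      positivity
    · have hlt : mu * d / (W * S) < 1 - W := by linarith
      have hpos : 0 < 1 - W := lt_trans (by positivity) hlt
      rw [div_lt_iff₀ (by positivity)] at hlt
      have := mul_pos (mul_pos hpos hW0) (sub_pos.2 hlt)
      linarith
end

section
/- Let d ≥ 1, λ ∈ ℝ, η ∈ ℝ with η ≠ −1, and let w : ℝ → Fin d → ℝ be a trajectory of continuous gradient descent with noise augmentation: for each i and each t, the function t ↦ w t i has derivative −2λ·(1 + η)·(W(t)·(1 + η) − 1)·(W(t)/(w t i)) at t, where W(t) = ∏ i, w t i and all w t i ≠ 0. Then the loss ℓ(t) = (W(t) − 1)² has derivative ℓ'(t) = −4λ·(1 + η)²·W(t)²·(∑ i, 1/(w t i)²)·(W(t) − 1)·(W(t) − 1/(1 + η)) at every t. In particular, if λ > 0 then ℓ'(t) < 0 whenever (W(t) − 1)·(W(t) − 1/(1 + η)) > 0, i.e., the loss strictly decreases outside the noise band. -/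
/-- The product rule for a finite product of nonvanishing factors, with cofactors written as quotients. -/
theorem hasDerivAt_prod_of_ne_zero {ι : Type*} [Fintype ι] {f : ℝ → ι → ℝ} {f' : ι → ℝ} {t : ℝ}
    (hf : ∀ i, HasDerivAt (fun s => f s i) (f' i) t) (hne : ∀ i, f t i ≠ 0) :
    HasDerivAt (fun s => ∏ i, f s i) (∑ i, (∏ l, f t l) / f t i * f' i) t := by
  classical
  refine (HasDerivAt.fun_finsetProd (u := Finset.univ) fun i _ => hf i).congr_deriv
    (Finset.sum_congr rfl fun i hi => ?_)
  rw [smul_eq_mul, ← Finset.mul_prod_erase _ _ hi, mul_div_cancel_left₀ _ (hne i)]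

/-- For continuous gradient descent with noise augmentation `(1 + η)` on the
deep linear network, the loss `ℓ(t) = (W(t) − 1)²` has derivative
`−4λ(1 + η)²W²(∑ 1/wᵢ²)(W − 1)(W − 1/(1 + η))`; in particular, for `λ > 0` the
loss strictly decreases outside the noise band. -/
theorem noise_augmentation_loss_derivative
    (d : ℕ) (hd : 1 ≤ d) (lam eta : ℝ) (heta : eta ≠ -1)
    (w : ℝ → Fin d → ℝ) (hw : ∀ t i, w t i ≠ 0)
    (hderiv : ∀ i t, HasDerivAt (fun s => w s i)
      (-2 * lam * (1 + eta) * ((∏ l, w t l) * (1 + eta) - 1) * ((∏ l, w t l) / w t i)) t)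
    (t : ℝ) :
    HasDerivAt (fun s => ((∏ l, w s l) - 1) ^ 2)
      (-4 * lam * (1 + eta) ^ 2 * (∏ l, w t l) ^ 2 * (∑ l, 1 / (w t l) ^ 2) *
        ((∏ l, w t l) - 1) * ((∏ l, w t l) - 1 / (1 + eta))) t ∧
    (0 < lam → 0 < ((∏ l, w t l) - 1) * ((∏ l, w t l) - 1 / (1 + eta)) →
      -4 * lam * (1 + eta) ^ 2 * (∏ l, w t l) ^ 2 * (∑ l, 1 / (w t l) ^ 2) *
        ((∏ l, w t l) - 1) * ((∏ l, w t l) - 1 / (1 + eta)) < 0) := by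
  have h_eta : 1 + eta ≠ 0 := fun h => heta (by linarith)
  refine ⟨?_, fun hlam hband => ?_⟩
  · refine (((hasDerivAt_prod_of_ne_zero (fun i => hderiv i t) (hw t)).sub_const 1).fun_pow
      2).congr_deriv ?_
    have h_sum : ∑ i, (∏ l, w t l) / w t i * (-2 * lam * (1 + eta) *
        ((∏ l, w t l) * (1 + eta) - 1) * ((∏ l, w t l) / w t i)) =
        -2 * lam * (1 + eta) * ((∏ l, w t l) * (1 + eta) - 1) * (∏ l, w t l) ^ 2 *
          ∑ i, 1 / w t i ^ 2 := by
      rw [Finset.mul_sum]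
      exact Finset.sum_congr rfl fun i _ => by ring
    rw [h_sum]
    field_simp
    ring
  · have : Nonempty (Fin d) := ⟨⟨0, hd⟩⟩
    have h_prod : 0 < (∏ l, w t l) ^ 2 :=
      sq_pos_of_ne_zero (Finset.prod_ne_zero_iff.mpr fun i _ => hw t i)
    have h_sum : 0 < ∑ l, 1 / w t l ^ 2 :=
      Finset.sum_pos (fun i _ => one_div_pos.mpr (sq_pos_of_ne_zero (hw t i)))
        Finset.univ_nonempty
    have h_sq : 0 < (1 + eta) ^ 2 := sq_pos_of_ne_zero h_eta
    have h_pos := mul_pos (mul_pos (mul_pos (mul_pos hlam h_sq) h_prod) h_sum) hband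
    linarith
end

section
/- Let d ≥ 2, λ ∈ ℝ, η ∈ ℝ with η ≠ −1, w : Fin d → ℝ with all w i ≠ 0, W = ∏ i, w i, and define the noise-augmented gradient descent step w' i = w i − 2λ·(1 + η)·(W·(1 + η) − 1)·(W/(w i)). Then for any indices i ≠ j the layer imbalance satisfies the exact identity (w' i)² − (w' j)² = ((w i)² − (w j)²)·(1 − 4λ²·(1 + η)⁴·(W − 1/(1 + η))²·W²/((w i)·(w j))²). -/
/-- Exact identity for the layer imbalance after one noise-augmented gradient
descent step on the deep linear network:
`D'_ij = D_ij · (1 − 4λ²(1 + η)⁴(W − 1/(1 + η))²W²/((w i)(w j))²)`. -/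
theorem noise_step_imbalance_identity
    (d : ℕ) (hd : 2 ≤ d) (lam eta : ℝ) (heta : eta ≠ -1)
    (w : Fin d → ℝ) (hw : ∀ i, w i ≠ 0)
    (w' : Fin d → ℝ)
    (hw' : ∀ i, w' i = w i -
      2 * lam * (1 + eta) * ((∏ l, w l) * (1 + eta) - 1) * ((∏ l, w l) / w i))
    (i j : Fin d) (hij : i ≠ j) :
    (w' i) ^ 2 - (w' j) ^ 2 =
      ((w i) ^ 2 - (w j) ^ 2) *
        (1 - 4 * lam ^ 2 * (1 + eta) ^ 4 * ((∏ l, w l) - 1 / (1 + eta)) ^ 2 *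
          (∏ l, w l) ^ 2 / (w i * w j) ^ 2) := by
  have hi := hw i
  have hj := hw j
  have hne : 1 + eta ≠ 0 := fun h => heta (by linarith)
  rw [hw' i, hw' j]
  generalize ∏ l, w l = W
  field_simp
  ring
end

section
/- Let d ≥ 1, λ, η ∈ ℝ, and let w : ℝ → Fin d → ℝ be a trajectory of continuous SGD: for each i and each t, the function t ↦ w t i has derivative −2λ·(W(t) − 1 + η)·(W(t)/(w t i)) at t, where W(t) = ∏ i, w t i and all w t i ≠ 0. Then: (a) the loss ℓ(t) = (W(t) − 1)² has derivative ℓ'(t) = −4λ·W(t)²·(∑ i, 1/(w t i)²)·(W(t) − 1)·(W(t) − 1 + η) at every t, so for λ > 0 the loss strictly decreases whenever (W(t) − 1)·(W(t) − 1 + η) > 0; and (b) for any indices i, j the layer imbalance (w t i)² − (w t j)² has derivative 0 at every t, hence is constant along the trajectory. -/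
/-- For continuous SGD with noise realization `η` on the deep linear network:
(a) the loss has derivative `−4λW²(∑ 1/wᵢ²)(W − 1)(W − 1 + η)`, so for `λ > 0`
it strictly decreases outside the SGD noise band; and (b) the layer imbalance
has zero derivative, hence is constant along the trajectory. -/
theorem continuous_sgd_loss_and_imbalance
    (d : ℕ) (hd : 1 ≤ d) (lam eta : ℝ)
    (w : ℝ → Fin d → ℝ) (hw : ∀ t i, w t i ≠ 0)
    (hderiv : ∀ i t, HasDerivAt (fun s => w s i)
      (-2 * lam * ((∏ l, w t l) - 1 + eta) * ((∏ l, w t l) / w t i)) t) :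
    (∀ t, HasDerivAt (fun s => ((∏ l, w s l) - 1) ^ 2)
        (-4 * lam * (∏ l, w t l) ^ 2 * (∑ l, 1 / (w t l) ^ 2) *
          ((∏ l, w t l) - 1) * ((∏ l, w t l) - 1 + eta)) t ∧
      (0 < lam → 0 < ((∏ l, w t l) - 1) * ((∏ l, w t l) - 1 + eta) →
        -4 * lam * (∏ l, w t l) ^ 2 * (∑ l, 1 / (w t l) ^ 2) *
          ((∏ l, w t l) - 1) * ((∏ l, w t l) - 1 + eta) < 0)) ∧
    ∀ i j : Fin d,
      (∀ t, HasDerivAt (fun s => (w s i) ^ 2 - (w s j) ^ 2) 0 t) ∧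
      ∀ t, (w t i) ^ 2 - (w t j) ^ 2 = (w 0 i) ^ 2 - (w 0 j) ^ 2 := by
  constructor
  · intro t
    have hprod := HasDerivAt.fun_finsetProd (u := Finset.univ)
      fun i _ => hderiv i t
    refine ⟨?_, fun hlam hband => ?_⟩
    · refine ((hprod.sub_const 1).pow 2).congr_deriv ?_
      have hsum : ∑ i, (∏ j ∈ Finset.univ.erase i, w t j) •
            (-2 * lam * ((∏ l, w t l) - 1 + eta) * ((∏ l, w t l) / w t i)) =
          -2 * lam * ((∏ l, w t l) - 1 + eta) * (∏ l, w t l) ^ 2 *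
            ∑ l, 1 / (w t l) ^ 2 := by
        rw [Finset.mul_sum]
        refine Finset.sum_congr rfl fun i hi => ?_
        have herase : ∏ j ∈ Finset.univ.erase i, w t j = (∏ l, w t l) / w t i :=
          eq_div_of_mul_eq (hw t i) (Finset.prod_erase_mul _ _ hi)
        rw [herase, smul_eq_mul]
        ring
      rw [hsum]
      ring
    · have hprod_ne : ∏ l, w t l ≠ 0 := Finset.prod_ne_zero_iff.mpr fun i _ => hw t i
      have hsum_pos : 0 < ∑ l, 1 / (w t l) ^ 2 :=
        Finset.sum_pos (fun i _ => one_div_pos.mpr (sq_pos_of_ne_zero (hw t i)))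
          ⟨⟨0, hd⟩, Finset.mem_univ _⟩
      have hpos := mul_pos (mul_pos (mul_pos hlam (sq_pos_of_ne_zero hprod_ne)) hsum_pos) hband
      linarith
  · intro i j
    have himb : ∀ t, HasDerivAt (fun s => (w s i) ^ 2 - (w s j) ^ 2) 0 t := fun t => by
      refine (((hderiv i t).pow 2).sub ((hderiv j t).pow 2)).congr_deriv ?_
      have hi := hw t i
      have hj := hw t j
      field_simp
      ring
    exact ⟨himb, fun t => is_const_of_deriv_eq_zero
      (fun s => (himb s).differentiableAt) (fun s => (himb s).deriv) t 0⟩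
end

section
/- Let d ≥ 2, λ, η ∈ ℝ, w : Fin d → ℝ with all w i ≠ 0, W = ∏ i, w i, and define the discrete SGD step w' i = w i − 2λ·(W − 1 + η)·(W/(w i)). Then for any indices i ≠ j the layer imbalance satisfies the exact identity (w' i)² − (w' j)² = ((w i)² − (w j)²)·(1 − 4λ²·(W − 1 + η)²·W²/((w i)·(w j))²). -/
/-- Exact identity for the layer imbalance after one discrete SGD step on the
deep linear network: `D'_ij = D_ij · (1 − 4λ²(W − 1 + η)²W²/((w i)(w j))²)`. -/
theorem sgd_step_imbalance_identity
    (d : ℕ) (hd : 2 ≤ d) (lam eta : ℝ) (w : Fin d → ℝ) (hw : ∀ i, w i ≠ 0)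
    (w' : Fin d → ℝ)
    (hw' : ∀ i, w' i = w i - 2 * lam * ((∏ l, w l) - 1 + eta) * ((∏ l, w l) / w i))
    (i j : Fin d) (hij : i ≠ j) :
    (w' i) ^ 2 - (w' j) ^ 2 =
      ((w i) ^ 2 - (w j) ^ 2) *
        (1 - 4 * lam ^ 2 * ((∏ l, w l) - 1 + eta) ^ 2 * (∏ l, w l) ^ 2 /
          (w i * w j) ^ 2) := by
  have hi := hw i
  have hj := hw j
  rw [hw' i, hw' j]
  generalize ∏ l, w l = W
  field_simp
  ring
end

section
/- (Theorem 4.) Let d ≥ 2, let w : Fin d → ℝ with all w i ≠ 0 and W = ∏ i, w i, and let δ, η ∈ ℝ satisfy 0 < δ < 1, |W − 1| < δ, and |η| ≤ δ. Define the adaptive learning rate λ = 1/(2δ·(1 + δ)·∑ i, 1/(w i)²) and the discrete SGD step w' i = w i − 2λ·(W − 1 + η)·(W/(w i)). Then for any indices i ≠ j, the factor k = 1 − 4λ²·(W − 1 + η)²·W²/((w i)·(w j))² satisfies 0 ≤ k ≤ 1, and consequently the layer imbalance monotonically decreases: |(w' i)² − (w' j)²| ≤ |(w i)² − (w j)²|.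 -/
/-- If `|c| (1/x² + 1/y²) ≤ 2`, then `c² / (x y)² ≤ 1`, by the AM-GM inequality. -/
theorem sq_div_mul_sq_le_one_of_abs_mul_le_two {x y c : ℝ} (hx : x ≠ 0) (hy : y ≠ 0)
    (hc : |c| * (1 / x ^ 2 + 1 / y ^ 2) ≤ 2) : c ^ 2 / (x * y) ^ 2 ≤ 1 := by
  have hxy : 0 < |x * y| := abs_pos.mpr (mul_ne_zero hx hy)
  have amgm : 2 / |x * y| ≤ 1 / x ^ 2 + 1 / y ^ 2 := by
    have h := sq_nonneg (1 / |x| - 1 / |y|)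
    have e : (1 / |x| - 1 / |y|) ^ 2 = 1 / x ^ 2 + 1 / y ^ 2 - 2 / |x * y| := by
      rw [abs_mul, ← sq_abs x, ← sq_abs y]
      have := abs_ne_zero.mpr hx
      have := abs_ne_zero.mpr hy
      field_simp
      ring
    linarith
  have h : |c| * (2 / |x * y|) ≤ 2 :=
    (mul_le_mul_of_nonneg_left amgm (abs_nonneg c)).trans hc
  rw [mul_div_assoc', div_le_iff₀ hxy] at h
  exact div_le_one_of_le₀ (sq_le_sq.mpr (by linarith)) (sq_nonneg _)

/-- A step `x ↦ x - c / x`, `y ↦ y - c / y` rescales `x² - y²` by `1 - c² / (x y)²`. -/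
theorem sub_div_sq_sub_sub_div_sq {x y : ℝ} (c : ℝ) (hx : x ≠ 0) (hy : y ≠ 0) :
    (x - c / x) ^ 2 - (y - c / y) ^ 2 = (1 - c ^ 2 / (x * y) ^ 2) * (x ^ 2 - y ^ 2) := by
  field_simp
  ring

/-- (Theorem 4.) For one discrete SGD step on the deep linear network with
`0 < δ < 1`, `|W − 1| < δ`, `|η| ≤ δ`, and adaptive learning rate
`λ = 1/(2δ(1 + δ)∑ i, 1/(w i)²)`, the contraction factor
`k = 1 − 4λ²(W − 1 + η)²W²/((w i)(w j))²` satisfies `0 ≤ k ≤ 1`; hence the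
layer imbalance monotonically decreases. -/
theorem sgd_adaptive_lr_imbalance_decreases
    (d : ℕ) (hd : 2 ≤ d) (w : Fin d → ℝ) (hw : ∀ i, w i ≠ 0)
    (delta eta : ℝ) (hdelta : 0 < delta) (hdelta' : delta < 1)
    (hW : |(∏ i, w i) - 1| < delta) (heta : |eta| ≤ delta)
    (lam : ℝ) (hlam : lam = 1 / (2 * delta * (1 + delta) * ∑ i, 1 / (w i) ^ 2))
    (w' : Fin d → ℝ)
    (hw' : ∀ i, w' i = w i - 2 * lam * ((∏ l, w l) - 1 + eta) * ((∏ l, w l) / w i))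
    (i j : Fin d) (hij : i ≠ j) :
    (0 ≤ 1 - 4 * lam ^ 2 * ((∏ l, w l) - 1 + eta) ^ 2 * (∏ l, w l) ^ 2 /
        (w i * w j) ^ 2 ∧
      1 - 4 * lam ^ 2 * ((∏ l, w l) - 1 + eta) ^ 2 * (∏ l, w l) ^ 2 /
        (w i * w j) ^ 2 ≤ 1) ∧
    |(w' i) ^ 2 - (w' j) ^ 2| ≤ |(w i) ^ 2 - (w j) ^ 2| := by
  set W := ∏ l, w l
  set S := ∑ l, 1 / (w l) ^ 2
  have hS : 1 / (w i) ^ 2 + 1 / (w j) ^ 2 ≤ S := by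
    rw [← Finset.sum_pair (f := fun l => 1 / (w l) ^ 2) hij]
    exact Finset.sum_le_sum_of_subset_of_nonneg (Finset.subset_univ _)
      fun l _ _ => by positivity
  have hS_pos : 0 < S := by
    have := hw i
    have := hw j
    exact lt_of_lt_of_le (by positivity) hS
  have hlam_pos : 0 < lam := by rw [hlam]; positivity
  have hlam_mul : lam * (2 * delta * (1 + delta) * S) = 1 := by
    rw [hlam]
    exact one_div_mul_cancel (by positivity)
  have hgrad : |W - 1 + eta| ≤ 2 * delta := by
    linarith [abs_add_le (W - 1) eta]
  have hW_abs : |W| ≤ 1 + delta := by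
    rw [abs_lt] at hW
    exact abs_le.mpr ⟨by linarith, by linarith⟩
  set c := 2 * lam * (W - 1 + eta) * W with hc_def
  have hc : |c| ≤ 2 * lam * (2 * delta) * (1 + delta) := by
    rw [hc_def, abs_mul, abs_mul, abs_of_pos (by positivity : 0 < 2 * lam)]
    gcongr
  have hcS : |c| * (1 / (w i) ^ 2 + 1 / (w j) ^ 2) ≤ 2 :=
    calc |c| * (1 / (w i) ^ 2 + 1 / (w j) ^ 2)
        ≤ 2 * lam * (2 * delta) * (1 + delta) * S := by gcongr
      _ = 2 := by linear_combination 2 * hlam_mul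
  have hle := sq_div_mul_sq_le_one_of_abs_mul_le_two (hw i) (hw j) hcS
  have hnonneg : 0 ≤ c ^ 2 / (w i * w j) ^ 2 := by positivity
  have hfactor : 4 * lam ^ 2 * (W - 1 + eta) ^ 2 * W ^ 2 = c ^ 2 := by
    rw [hc_def]
    ring
  have hstep : ∀ l, w' l = w l - c / w l := fun l => by
    rw [hw' l, hc_def, mul_div_assoc]
  rw [hfactor]
  refine ⟨⟨by linarith, by linarith⟩, ?_⟩
  rw [hstep i, hstep j, sub_div_sq_sub_sub_div_sq c (hw i) (hw j), abs_mul,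
    abs_of_nonneg (by linarith)]
  exact mul_le_of_le_one_left (abs_nonneg _) (by linarith)
end
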